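/- arXiv:1405.6390 — 2 statements merged into one kernel-verified Lean document; each statement's English description precedes it below -/
import Mathlib

section
/- If two e-admissible pairs (𝔪,𝔫) and (𝔪′,𝔫′) are equivalent, then the algebras H(𝔪,𝔫) and H(𝔪′,𝔫′) are isomorphic. -/
open Module LieAlgebra

noncomputable section

variable {L : Type*} [LieRing L] [LieAlgebra ℂ L]

/-- The pair `(𝔪, 𝔫)` of subalgebras is `e`-admissible relative to the `ℤ`-grading
`g : ℤ → Submodule ℂ L` with `e ∈ g a` (`a > 1`): `𝔪`, `𝔫` are Lie subalgebras, are
`Γ`-graded, and conditions (A2)–(A6) of Sadaka's Definition 2.2 hold. -/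
def IsAdmissiblePair (g : ℤ → Submodule ℂ L) (e : L) (a : ℤ)
    (m n : Submodule ℂ L) : Prop :=
  -- `𝔪` and `𝔫` are Lie subalgebras of `𝔤`
  (∀ x ∈ m, ∀ y ∈ m, ⁅x, y⁆ ∈ m) ∧
  (∀ x ∈ n, ∀ y ∈ n, ⁅x, y⁆ ∈ n) ∧
  -- (A2): `𝔪`, `𝔫` are `Γ`-graded and `𝔤_{≤ -a} ⊆ 𝔪 ⊆ 𝔫 ⊆ 𝔤_{<0}`
  m = (⨆ j : ℤ, g j ⊓ m) ∧
  n = (⨆ j : ℤ, g j ⊓ n) ∧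
  (⨆ j ≤ -a, g j) ≤ m ∧ m ≤ n ∧ n ≤ (⨆ j < (0:ℤ), g j) ∧
  -- (A3): `𝔪^⊥ ∩ [𝔤, e] = [𝔫, e]`
  (LinearMap.BilinForm.orthogonal (killingForm ℂ L) m ⊓ LinearMap.range (ad ℂ L e)
      = Submodule.map (ad ℂ L e) n) ∧
  -- (A4): `𝔫 ∩ 𝔤^e = 0`
  n ⊓ LinearMap.ker (ad ℂ L e) = ⊥ ∧
  -- (A5): `[𝔫, 𝔪] ⊆ 𝔪`
  (∀ x ∈ n, ∀ y ∈ m, ⁅x, y⁆ ∈ m) ∧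
  -- (A6): `dim 𝔪 + dim 𝔫 = dim 𝔤 - dim 𝔤^e`
  finrank ℂ ↥m + finrank ℂ ↥n
    = finrank ℂ L - finrank ℂ ↥(LinearMap.ker (ad ℂ L e))

/-- `g : ℤ → Submodule ℂ L` is a `ℤ`-grading of the Lie algebra `L`. -/
def IsZGrading (g : ℤ → Submodule ℂ L) : Prop :=
  DirectSum.IsInternal g ∧ ∀ i j : ℤ, ∀ x ∈ g i, ∀ y ∈ g j, ⁅x, y⁆ ∈ g (i + j)

/-- Two `e`-admissible pairs are *comparable* if they are `e`-admissible relative to one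
common `ℤ`-grading `Γ` and one is squeezed inside the other
(`𝔪 ⊆ 𝔪′ ⊆ 𝔫′ ⊆ 𝔫` or `𝔪′ ⊆ 𝔪 ⊆ 𝔫 ⊆ 𝔫′`). -/
def ComparablePairs (e : L) (p q : Submodule ℂ L × Submodule ℂ L) : Prop :=
  ∃ (g : ℤ → Submodule ℂ L) (a : ℤ), IsZGrading g ∧ 1 < a ∧ e ∈ g a ∧
    IsAdmissiblePair g e a p.1 p.2 ∧ IsAdmissiblePair g e a q.1 q.2 ∧
    ((p.1 ≤ q.1 ∧ q.1 ≤ q.2 ∧ q.2 ≤ p.2) ∨ (q.1 ≤ p.1 ∧ p.1 ≤ p.2 ∧ p.2 ≤ q.2))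

/-- Two `e`-admissible pairs are *equivalent* if they are joined by a finite chain of
`e`-admissible pairs in which consecutive pairs are comparable. -/
def EquivalentPairs (e : L) : (Submodule ℂ L × Submodule ℂ L) →
    (Submodule ℂ L × Submodule ℂ L) → Prop :=
  Relation.ReflTransGen (ComparablePairs e)

/-- The universal enveloping algebra of `𝔤`. -/
abbrev UEA (L : Type*) [LieRing L] [LieAlgebra ℂ L] := UniversalEnvelopingAlgebra ℂ L

/-- The left ideal `I(𝔪)` of `U(𝔤)` generated by the elements `x − χ(x)`, `x ∈ 𝔪`,
where `χ = ⟨e, ·⟩`. -/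
def lideal (e : L) (m : Submodule ℂ L) : Submodule (UEA L) (UEA L) :=
  Submodule.span (UEA L)
    ((fun x : L => (UniversalEnvelopingAlgebra.ι ℂ x : UEA L)
        - algebraMap ℂ (UEA L) (killingForm ℂ L e x)) '' (m : Set L))

/-- `I(𝔪)`, viewed as a `ℂ`-subspace of `U(𝔤)`. -/
def lidealC (e : L) (m : Submodule ℂ L) : Submodule ℂ (UEA L) :=
  (lideal e m).restrictScalars ℂ

/-- The `ℂ`-subspace of `U(𝔤)` of elements `u` with `[ι x, u] ∈ I(𝔪)` for all `x ∈ 𝔫`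
(i.e. elements whose class in `Q(𝔪)` is `ad 𝔫`-invariant). -/
def invSet (e : L) (m n : Submodule ℂ L) : Submodule ℂ (UEA L) :=
  ⨅ x ∈ n, Submodule.comap
    (LinearMap.mulLeft ℂ ((UniversalEnvelopingAlgebra.ι ℂ x : UEA L))
      - LinearMap.mulRight ℂ ((UniversalEnvelopingAlgebra.ι ℂ x : UEA L)))
    (lidealC e m)

/-- The W-algebra `H(𝔪, 𝔫) = Q(𝔪)^{ad 𝔫}`, as a `ℂ`-subspace of `Q(𝔪) = U(𝔤)/I(𝔪)`. -/
def Hsub (e : L) (m n : Submodule ℂ L) : Submodule ℂ (UEA L ⧸ lidealC e m) :=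
  (invSet e m n).map (lidealC e m).mkQ

/-- The statement that the W-algebras `H(𝔪₁, 𝔫₁)` and `H(𝔪₂, 𝔫₂)` are isomorphic as
unital `ℂ`-algebras: there is a `ℂ`-linear equivalence preserving the class of `1` and
compatible with the multiplications induced from `U(𝔤)`. -/
def WAlgebraIso (e : L) (m₁ n₁ m₂ n₂ : Submodule ℂ L) : Prop :=
  ∃ φ : ↥(Hsub e m₁ n₁) ≃ₗ[ℂ] ↥(Hsub e m₂ n₂),
    (∀ p : ↥(Hsub e m₁ n₁), (p : UEA L ⧸ lidealC e m₁) = Submodule.Quotient.mk 1 →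
      ((φ p : UEA L ⧸ lidealC e m₂) = Submodule.Quotient.mk 1)) ∧
    ∀ p q r : ↥(Hsub e m₁ n₁),
      (∃ u v : UEA L, u ∈ invSet e m₁ n₁ ∧ v ∈ invSet e m₁ n₁ ∧
        (p : UEA L ⧸ lidealC e m₁) = Submodule.Quotient.mk u ∧
        (q : UEA L ⧸ lidealC e m₁) = Submodule.Quotient.mk v ∧
        (r : UEA L ⧸ lidealC e m₁) = Submodule.Quotient.mk (u * v)) →
      (∃ u' v' : UEA L, u' ∈ invSet e m₂ n₂ ∧ v' ∈ invSet e m₂ n₂ ∧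
        (φ p : UEA L ⧸ lidealC e m₂) = Submodule.Quotient.mk u' ∧
        (φ q : UEA L ⧸ lidealC e m₂) = Submodule.Quotient.mk v' ∧
        (φ r : UEA L ⧸ lidealC e m₂) = Submodule.Quotient.mk (u' * v'))

section WeylRelation

variable {V : Type*} [AddCommGroup V] [Module ℂ V]

/-- If `[D, R] = 1`, then `Dᵏ R = R Dᵏ + k Dᵏ⁻¹`. -/
lemma iterate_succ_apply_of_commutator_eq_one {D R : V →ₗ[ℂ] V}
    (h : ∀ v, D (R v) = R (D v) + v) (k : ℕ) (v : V) :
    (D ^ (k + 1)) (R v) = R ((D ^ (k + 1)) v) + ((k + 1 : ℕ) : ℂ) • (D ^ k) v := by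
  induction k with
  | zero => simp [h]
  | succ k ih =>
    rw [pow_succ' D (k + 1), Module.End.mul_apply, ih, map_add, h, map_smul,
      ← Module.End.mul_apply D (D ^ k), ← pow_succ', Module.End.mul_apply]
    push_cast
    module

lemma eq_zero_of_commutator_eq_one {D R : V →ₗ[ℂ] V}
    (h : ∀ v, D (R v) = R (D v) + v) {v : V} (hv : D (R v) = 0)
    (hnil : ∃ k : ℕ, (D ^ k) v = 0) : v = 0 := by
  obtain ⟨k, hk⟩ := hnil
  induction k with
  | zero => simpa using hk
  | succ k ih =>
    apply ih
    have h1 := iterate_succ_apply_of_commutator_eq_one h k v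
    rw [hk, pow_succ, Module.End.mul_apply, hv, map_zero, map_zero, zero_add] at h1
    exact (smul_eq_zero.mp h1.symm).resolve_left (by exact_mod_cast k.succ_ne_zero)

lemma exists_add_apply_of_commutator_eq_one {D R : V →ₗ[ℂ] V}
    (h : ∀ v, D (R v) = R (D v) + v) {v : V} (hnil : ∃ k : ℕ, (D ^ k) v = 0) :
    ∃ u w, D u = 0 ∧ v = u + R w := by
  obtain ⟨k, hk⟩ := hnil
  induction k generalizing v with
  | zero => exact ⟨0, 0, by simp, by simpa using hk⟩
  | succ k ih =>
    cases k with
    | zero => exact ⟨v, 0, by simpa using hk, by simp⟩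
    | succ k =>
      have hk0 : ((k + 1 : ℕ) : ℂ) ≠ 0 := by exact_mod_cast k.succ_ne_zero
      have h1 := iterate_succ_apply_of_commutator_eq_one h k (D v)
      rw [← Module.End.mul_apply (D ^ (k + 1)) D, ← Module.End.mul_apply (D ^ k) D, ← pow_succ,
        ← pow_succ, hk, map_zero, zero_add] at h1
      obtain ⟨u, w, hu, hw⟩ := ih (v := v - ((k + 1 : ℕ) : ℂ)⁻¹ • R (D v)) (by
        rw [map_sub, map_smul, h1, smul_smul, inv_mul_cancel₀ hk0, one_smul, sub_self])
      refine ⟨u, w + ((k + 1 : ℕ) : ℂ)⁻¹ • D v, hu, ?_⟩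
      rw [map_add, map_smul, ← add_assoc, ← hw, sub_add_cancel]

end WeylRelation

section Enveloping

attribute [local instance] LieRing.ofAssociativeRing LieAlgebra.ofAssociativeAlgebra

local notation "ι" => UniversalEnvelopingAlgebra.ι ℂ

lemma UEA.ι_lie (x y : L) : (ι ⁅x, y⁆ : UEA L) = ι x * ι y - ι y * ι x := by
  rw [LieHom.map_lie, LieRing.of_associative_ring_bracket]

lemma UEA.mem_of_ι_mem (S : Subalgebra ℂ (UEA L)) (hι : ∀ x : L, ι x ∈ S) (u : UEA L) :
    u ∈ S := by
  let f : L →ₗ⁅ℂ⁆ S :=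
    { toFun := fun x => ⟨ι x, hι x⟩
      map_add' := fun x y => Subtype.ext (by simp)
      map_smul' := fun c x => Subtype.ext (by simp)
      map_lie' := fun {x y} => Subtype.ext (by
        simp [LieRing.of_associative_ring_bracket]) }
  have h : S.val.comp (UniversalEnvelopingAlgebra.lift ℂ f) = AlgHom.id ℂ (UEA L) := by
    apply UniversalEnvelopingAlgebra.hom_ext
    ext x
    simp only [LieHom.coe_comp, Function.comp_apply, AlgHom.coe_toLieHom, AlgHom.comp_apply,
      UniversalEnvelopingAlgebra.lift_ι_apply]
    rfl
  have h1 := DFunLike.congr_fun h u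
  rw [AlgHom.id_apply] at h1
  rw [← h1]
  exact (UniversalEnvelopingAlgebra.lift ℂ f u).2

/-- The adjoint action of `x : L` on the universal enveloping algebra. -/
def UEA.adjoint (x : L) : UEA L →ₗ[ℂ] UEA L :=
  LinearMap.mulLeft ℂ (ι x : UEA L) - LinearMap.mulRight ℂ (ι x : UEA L)

lemma UEA.adjoint_apply (x : L) (u : UEA L) : UEA.adjoint x u = ι x * u - u * ι x := rfl

lemma UEA.adjoint_mul (x : L) (u v : UEA L) :
    UEA.adjoint x (u * v) = UEA.adjoint x u * v + u * UEA.adjoint x v := by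
  simp only [UEA.adjoint_apply]; noncomm_ring

lemma UEA.adjoint_lie (x y : L) (u : UEA L) :
    UEA.adjoint ⁅x, y⁆ u = UEA.adjoint x (UEA.adjoint y u) - UEA.adjoint y (UEA.adjoint x u) := by
  simp only [UEA.adjoint_apply, UEA.ι_lie]; noncomm_ring

lemma UEA.adjoint_ι (x y : L) : UEA.adjoint x (ι y : UEA L) = ι ⁅x, y⁆ := by
  rw [UEA.adjoint_apply, UEA.ι_lie]

lemma UEA.adjoint_algebraMap (x : L) (c : ℂ) : UEA.adjoint x (algebraMap ℂ (UEA L) c) = 0 := by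
  rw [UEA.adjoint_apply, Algebra.commutes, sub_self]

lemma UEA.adjoint_pow_ι (x y : L) (k : ℕ) :
    (UEA.adjoint x ^ k) (ι y : UEA L) = ι ((ad ℂ L x ^ k) y) := by
  induction k with
  | zero => simp
  | succ k ih => rw [pow_succ', Module.End.mul_apply, ih, UEA.adjoint_ι, pow_succ',
      Module.End.mul_apply, ad_apply]

lemma pow_apply_eq_zero_mono {V : Type*} [AddCommGroup V] [Module ℂ V] {D : V →ₗ[ℂ] V} {v : V}
    {k l : ℕ} (hkl : k ≤ l) (h : (D ^ k) v = 0) : (D ^ l) v = 0 := by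
  obtain ⟨j, rfl⟩ := Nat.exists_eq_add_of_le hkl
  rw [add_comm, pow_add, Module.End.mul_apply, h, map_zero]

lemma exists_pow_apply_add_eq_zero {V : Type*} [AddCommGroup V] [Module ℂ V] {D : V →ₗ[ℂ] V}
    {u v : V} (hu : ∃ k : ℕ, (D ^ k) u = 0) (hv : ∃ k : ℕ, (D ^ k) v = 0) :
    ∃ k : ℕ, (D ^ k) (u + v) = 0 := by
  obtain ⟨k, hk⟩ := hu
  obtain ⟨l, hl⟩ := hv
  exact ⟨k + l, by rw [map_add, pow_apply_eq_zero_mono (Nat.le_add_right k l) hk,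
    pow_apply_eq_zero_mono (Nat.le_add_left l k) hl, add_zero]⟩

lemma UEA.adjoint_pow_mul_eq_zero (x : L) (N : ℕ) : ∀ (k l : ℕ) (u v : UEA L), k + l ≤ N →
    (UEA.adjoint x ^ k) u = 0 → (UEA.adjoint x ^ l) v = 0 →
    (UEA.adjoint x ^ N) (u * v) = 0 := by
  induction N with
  | zero =>
    intro k l u v h hu hv
    obtain rfl : k = 0 := by omega
    simp_all
  | succ N ih =>
    intro k l u v h hu hv
    rcases k with _ | k
    · simp_all
    rcases l with _ | l
    · simp_all
    rw [pow_succ, Module.End.mul_apply, UEA.adjoint_mul, map_add,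
      ih k (l + 1) _ _ (by omega) (by rwa [pow_succ, Module.End.mul_apply] at hu) hv,
      ih (k + 1) l _ _ (by omega) hu (by rwa [pow_succ, Module.End.mul_apply] at hv), add_zero]

lemma UEA.adjoint_locally_nilpotent {x : L} (hx : ∀ y : L, ∃ k : ℕ, (ad ℂ L x ^ k) y = 0)
    (u : UEA L) : ∃ k : ℕ, (UEA.adjoint x ^ k) u = 0 := by
  let S : Subalgebra ℂ (UEA L) :=
    { carrier := {u | ∃ k : ℕ, (UEA.adjoint x ^ k) u = 0}
      mul_mem' := fun {u v} ⟨k, hk⟩ ⟨l, hl⟩ =>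
        ⟨k + l, UEA.adjoint_pow_mul_eq_zero x (k + l) k l u v le_rfl hk hl⟩
      add_mem' := fun hu hv => exists_pow_apply_add_eq_zero hu hv
      algebraMap_mem' := fun c => ⟨1, by rw [pow_one, UEA.adjoint_algebraMap]⟩ }
  refine UEA.mem_of_ι_mem S (fun y => ?_) u
  obtain ⟨k, hk⟩ := hx y
  exact ⟨k, by rw [UEA.adjoint_pow_ι, hk, map_zero]⟩

lemma mem_invSet {e : L} {m n : Submodule ℂ L} {u : UEA L} :
    u ∈ invSet e m n ↔ ∀ x ∈ n, UEA.adjoint x u ∈ lideal e m := by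
  simp only [invSet, Submodule.mem_iInf, Submodule.mem_comap]
  rfl

lemma generator_mem_lideal {e : L} {m : Submodule ℂ L} {y : L} (hy : y ∈ m) :
    (ι y : UEA L) - algebraMap ℂ (UEA L) (killingForm ℂ L e y) ∈ lideal e m :=
  Submodule.subset_span ⟨y, hy, rfl⟩

lemma lideal_mono {e : L} {m₁ m₂ : Submodule ℂ L} (h : m₁ ≤ m₂) : lideal e m₁ ≤ lideal e m₂ :=
  Submodule.span_mono (Set.image_mono h)

lemma mul_mem_lideal {e : L} {m : Submodule ℂ L} (a : UEA L) {u : UEA L} (hu : u ∈ lideal e m) :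
    a * u ∈ lideal e m := (lideal e m).smul_mem a hu

lemma mul_ι_mem_lideal {e : L} {m : Submodule ℂ L} {z : L}
    (hz : ∀ y ∈ m, ⁅z, y⁆ ∈ m ∧ killingForm ℂ L e ⁅z, y⁆ = 0) {u : UEA L}
    (hu : u ∈ lideal e m) : u * ι z ∈ lideal e m := by
  induction hu using Submodule.span_induction with
  | mem u hu =>
    obtain ⟨y, hy, rfl⟩ := hu
    have h1 := generator_mem_lideal (e := e) (hz y hy).1
    rw [(hz y hy).2, map_zero, sub_zero] at h1
    have h2 := mul_mem_lideal (ι z) (generator_mem_lideal (e := e) hy)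
    have h3 := sub_mem h2 h1
    convert h3 using 1
    simp only [UEA.ι_lie, sub_mul, mul_sub, Algebra.commutes]
    abel
  | zero => rw [zero_mul]; exact zero_mem _
  | add u v _ _ hu hv => rw [add_mul]; exact add_mem hu hv
  | smul a u _ hu => rw [smul_eq_mul, mul_assoc]; exact mul_mem_lideal a hu

lemma adjoint_mem_lideal {e : L} {m : Submodule ℂ L} {z : L}
    (hz : ∀ y ∈ m, ⁅z, y⁆ ∈ m ∧ killingForm ℂ L e ⁅z, y⁆ = 0) {u : UEA L}
    (hu : u ∈ lideal e m) : UEA.adjoint z u ∈ lideal e m :=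
  sub_mem (mul_mem_lideal _ hu) (mul_ι_mem_lideal hz hu)

lemma mul_mem_lideal_of_mem_invSet {e : L} {m n : Submodule ℂ L} (hmn : m ≤ n) {u v : UEA L}
    (hu : u ∈ lideal e m) (hv : v ∈ invSet e m n) : u * v ∈ lideal e m := by
  induction hu using Submodule.span_induction with
  | mem u hu =>
    obtain ⟨y, hy, rfl⟩ := hu
    have h := add_mem (mem_invSet.mp hv y (hmn hy))
      (mul_mem_lideal v (generator_mem_lideal (e := e) hy))
    convert h using 1
    simp only [UEA.adjoint_apply, sub_mul, mul_sub, Algebra.commutes]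
    abel
  | zero => rw [zero_mul]; exact zero_mem _
  | add u w _ _ hu hw => rw [add_mul]; exact add_mem hu hw
  | smul a u _ hu => rw [smul_eq_mul, mul_assoc]; exact mul_mem_lideal a hu

lemma mul_mem_invSet {e : L} {m n : Submodule ℂ L} (hmn : m ≤ n) {u v : UEA L}
    (hu : u ∈ invSet e m n) (hv : v ∈ invSet e m n) : u * v ∈ invSet e m n := by
  rw [mem_invSet] at hu ⊢
  intro x hx
  rw [UEA.adjoint_mul]
  exact add_mem (mul_mem_lideal_of_mem_invSet hmn (hu x hx) hv)
    (mul_mem_lideal u (mem_invSet.mp hv x hx))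

lemma one_mem_invSet {e : L} {m n : Submodule ℂ L} : (1 : UEA L) ∈ invSet e m n := by
  rw [mem_invSet]
  intro x _
  rw [← map_one (algebraMap ℂ (UEA L)), UEA.adjoint_algebraMap]
  exact zero_mem _

lemma invSet_mono {e : L} {m₁ n₁ m₂ n₂ : Submodule ℂ L} (hm : m₁ ≤ m₂) (hn : n₂ ≤ n₁) :
    invSet e m₁ n₁ ≤ invSet e m₂ n₂ := fun _ hu =>
  mem_invSet.mpr fun x hx => lideal_mono hm (mem_invSet.mp hu x (hn hx))

/-- The map `H(𝔪₁, 𝔫₁) → H(𝔪₂, 𝔫₂)` induced by the identity of `U(𝔤)` is bijective. -/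
def NaturalMapBijective (e : L) (m₁ n₁ m₂ n₂ : Submodule ℂ L) : Prop :=
  (∀ u ∈ invSet e m₁ n₁, u ∈ lideal e m₂ → u ∈ lideal e m₁) ∧
    ∀ u ∈ invSet e m₂ n₂, ∃ v ∈ invSet e m₁ n₁, u - v ∈ lideal e m₂

lemma NaturalMapBijective.trans {e : L} {m₁ n₁ m₂ n₂ m₃ n₃ : Submodule ℂ L}
    (hm : m₁ ≤ m₂) (hn : n₂ ≤ n₁) (hm' : m₂ ≤ m₃)
    (h₁ : NaturalMapBijective e m₁ n₁ m₂ n₂) (h₂ : NaturalMapBijective e m₂ n₂ m₃ n₃) :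
    NaturalMapBijective e m₁ n₁ m₃ n₃ := by
  refine ⟨fun u hu h => h₁.1 u hu (h₂.1 u (invSet_mono hm hn hu) h), fun u hu => ?_⟩
  obtain ⟨v, hv, huv⟩ := h₂.2 u hu
  obtain ⟨w, hw, hvw⟩ := h₁.2 v hv
  exact ⟨w, hw, by simpa using add_mem huv (lideal_mono hm' hvw)⟩

lemma mk_eq_mk_iff {e : L} {m : Submodule ℂ L} {u v : UEA L} :
    (Submodule.Quotient.mk u : UEA L ⧸ lidealC e m) = Submodule.Quotient.mk v ↔
      u - v ∈ lideal e m :=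
  Submodule.Quotient.eq _

/-- Enlarging `𝔪` by a line `ℂ y` and cutting down `𝔫` to a complement of `ℂ x`, where
`χ([x, y]) = 1`, does not change the invariants. -/
lemma naturalMapBijective_of_line {e x y : L} {m₁ n₁ m₂ n₂ : Submodule ℂ L}
    (hstab₁ : ∀ z ∈ n₁, ∀ w ∈ m₁, ⁅z, w⁆ ∈ m₁ ∧ killingForm ℂ L e ⁅z, w⁆ = 0)
    (hstab₂ : ∀ z ∈ n₂, ∀ w ∈ m₂, ⁅z, w⁆ ∈ m₂ ∧ killingForm ℂ L e ⁅z, w⁆ = 0)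
    (hm : m₂ = m₁ ⊔ Submodule.span ℂ {y}) (hn₂₁ : n₂ ≤ n₁)
    (hn : n₁ ≤ n₂ ⊔ Submodule.span ℂ {x})
    (hx : x ∈ n₁) (hy : ∀ z ∈ m₁, ⁅z, y⁆ ∈ m₁ ∧ killingForm ℂ L e ⁅z, y⁆ = 0)
    (hxy : ⁅x, y⁆ ∈ m₁) (hχ : killingForm ℂ L e ⁅x, y⁆ = 1)
    (hxn : ∀ z ∈ n₂, ⁅x, z⁆ ∈ n₂) (hnil : ∀ z : L, ∃ k : ℕ, (ad ℂ L x ^ k) z = 0) :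
    NaturalMapBijective e m₁ n₁ m₂ n₂ := by
  have hm₁₂ : m₁ ≤ m₂ := hm ▸ le_sup_left
  have hy' : ∀ z ∈ m₁, ⁅y, z⁆ ∈ m₁ ∧ killingForm ℂ L e ⁅y, z⁆ = 0 := fun z hz => by
    rw [← lie_skew, map_neg, neg_mem_iff, neg_eq_zero]; exact hy z hz
  set y' : UEA L := ι y - algebraMap ℂ (UEA L) (killingForm ℂ L e y) with hy'def
  have hmul : ∀ u ∈ lideal e m₁, u * y' ∈ lideal e m₁ := fun u hu => by
    rw [hy'def, mul_sub, ← Algebra.commutes]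
    exact sub_mem (mul_ι_mem_lideal hy' hu) (mul_mem_lideal _ hu)
  have hy'mem : y' ∈ lideal e m₂ := by
    refine generator_mem_lideal ?_
    rw [hm]
    exact Submodule.mem_sup_right (Submodule.mem_span_singleton_self y)
  have hdecomp : ∀ u ∈ lideal e m₂, ∃ w, u - w * y' ∈ lideal e m₁ := by
    intro u hu
    induction hu using Submodule.span_induction with
    | mem u hu =>
      obtain ⟨z, hz, rfl⟩ := hu
      rw [SetLike.mem_coe, hm, Submodule.mem_sup] at hz
      obtain ⟨z₁, hz₁, z₂, hz₂, rfl⟩ := hz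
      obtain ⟨c, rfl⟩ := Submodule.mem_span_singleton.mp hz₂
      refine ⟨algebraMap ℂ _ c, ?_⟩
      convert generator_mem_lideal (e := e) hz₁ using 1
      simp only [hy'def, map_add, map_smul, smul_eq_mul, mul_sub, map_mul, Algebra.smul_def]
      abel
    | zero => exact ⟨0, by simp⟩
    | add u v _ _ hu hv =>
      obtain ⟨w₁, h₁⟩ := hu
      obtain ⟨w₂, h₂⟩ := hv
      exact ⟨w₁ + w₂, by convert add_mem h₁ h₂ using 1; rw [add_mul]; abel⟩
    | smul a u _ hu =>
      obtain ⟨w, h⟩ := hu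
      exact ⟨a * w, by convert mul_mem_lideal a h using 1; rw [smul_eq_mul, mul_sub a, mul_assoc]⟩
  let D : (UEA L ⧸ lidealC e m₁) →ₗ[ℂ] (UEA L ⧸ lidealC e m₁) :=
    (lidealC e m₁).mapQ (lidealC e m₁) (UEA.adjoint x)
      fun u hu => adjoint_mem_lideal (hstab₁ x hx) hu
  let R : (UEA L ⧸ lidealC e m₁) →ₗ[ℂ] (UEA L ⧸ lidealC e m₁) :=
    (lidealC e m₁).mapQ (lidealC e m₁) (LinearMap.mulRight ℂ y') fun u hu => hmul u hu
  have hD : ∀ u : UEA L, D (Submodule.Quotient.mk u) = Submodule.Quotient.mk (UEA.adjoint x u) :=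
    fun u => rfl
  have hR : ∀ u : UEA L, R (Submodule.Quotient.mk u) = Submodule.Quotient.mk (u * y') :=
    fun u => rfl
  have hDR : ∀ v, D (R v) = R (D v) + v := by
    intro v
    obtain ⟨u, rfl⟩ := Submodule.Quotient.mk_surjective _ v
    rw [hR, hD, hD, hR, ← Submodule.Quotient.mk_add, mk_eq_mk_iff, UEA.adjoint_mul, hy'def, map_sub,
      UEA.adjoint_algebraMap, sub_zero, UEA.adjoint_ι]
    convert mul_mem_lideal u (generator_mem_lideal (e := e) hxy) using 1
    rw [hχ, map_one, mul_sub u, mul_one]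
    abel
  have hDnil : ∀ v, ∃ k : ℕ, (D ^ k) v = 0 := by
    intro v
    obtain ⟨u, rfl⟩ := Submodule.Quotient.mk_surjective _ v
    have hpow : ∀ k : ℕ, (D ^ k) (Submodule.Quotient.mk u) =
        Submodule.Quotient.mk ((UEA.adjoint x ^ k) u) := fun k => by
      induction k with
      | zero => rfl
      | succ k ih => rw [pow_succ', Module.End.mul_apply, ih, hD, pow_succ', Module.End.mul_apply]
    obtain ⟨k, hk⟩ := UEA.adjoint_locally_nilpotent hnil u
    exact ⟨k, by rw [hpow, hk, Submodule.Quotient.mk_zero]⟩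
  have hinj : ∀ u, UEA.adjoint x u ∈ lideal e m₁ → u ∈ lideal e m₂ → u ∈ lideal e m₁ := by
    intro u hu hu₂
    obtain ⟨w, hw⟩ := hdecomp u hu₂
    have h1 : (Submodule.Quotient.mk u : UEA L ⧸ lidealC e m₁) = R (Submodule.Quotient.mk w) := by
      rw [hR, mk_eq_mk_iff]; exact hw
    have h2 : D (R (Submodule.Quotient.mk w)) = 0 := by
      rw [← h1, hD]
      exact (Submodule.Quotient.mk_eq_zero _).mpr hu
    rw [eq_zero_of_commutator_eq_one hDR h2 (hDnil _), map_zero] at h1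
    exact (Submodule.Quotient.mk_eq_zero _).mp h1
  refine ⟨fun u hu hu₂ => hinj u (mem_invSet.mp hu x hx) hu₂, fun u hu => ?_⟩
  obtain ⟨v, w, hv, hvw⟩ := exists_add_apply_of_commutator_eq_one hDR
    (hDnil (Submodule.Quotient.mk u))
  obtain ⟨v, rfl⟩ := Submodule.Quotient.mk_surjective _ v
  obtain ⟨w, rfl⟩ := Submodule.Quotient.mk_surjective _ w
  rw [hD] at hv
  replace hv : UEA.adjoint x v ∈ lideal e m₁ := (Submodule.Quotient.mk_eq_zero _).mp hv
  rw [hR, ← Submodule.Quotient.mk_add, mk_eq_mk_iff] at hvw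
  have huv : u - v ∈ lideal e m₂ := by
    convert add_mem (lideal_mono hm₁₂ hvw) (mul_mem_lideal w hy'mem) using 1
    abel
  refine ⟨v, mem_invSet.mpr fun z hz => ?_, huv⟩
  have hn₂ : ∀ k : ℕ, ∀ z ∈ n₂, (ad ℂ L x ^ k) z = 0 → UEA.adjoint z v ∈ lideal e m₁ := by
    intro k
    induction k with
    | zero =>
      intro z _ hz
      obtain rfl : z = 0 := by simpa using hz
      simp [UEA.adjoint_apply]
    | succ k ih =>
      intro z hz hzk
      rw [pow_succ, Module.End.mul_apply, ad_apply] at hzk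
      apply hinj
      · have h1 := ih _ (hxn z hz) hzk
        rw [UEA.adjoint_lie] at h1
        replace h1 := add_mem h1 (adjoint_mem_lideal (hstab₁ z (hn₂₁ hz)) hv)
        simpa using h1
      · have h1 := sub_mem (mem_invSet.mp hu z hz) (adjoint_mem_lideal (hstab₂ z hz) huv)
        simpa using h1
  obtain ⟨z₁, hz₁, z₂, hz₂, rfl⟩ := Submodule.mem_sup.mp (hn hz)
  obtain ⟨c, rfl⟩ := Submodule.mem_span_singleton.mp hz₂
  obtain ⟨k, hk⟩ := hnil z₁
  convert add_mem (hn₂ k z₁ hz₁ hk) ((lidealC e m₁).smul_mem c hv) using 1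
  simp only [UEA.adjoint_apply, map_add, map_smul, add_mul, mul_add, smul_sub, smul_mul_assoc,
    mul_smul_comm]
  abel

lemma wAlgebraIso_of_naturalMapBijective {e : L} {m₁ n₁ m₂ n₂ : Submodule ℂ L}
    (hm : m₁ ≤ m₂) (hn : n₂ ≤ n₁) (hmn₁ : m₁ ≤ n₁) (hmn₂ : m₂ ≤ n₂)
    (h : NaturalMapBijective e m₁ n₁ m₂ n₂) :
    WAlgebraIso e m₁ n₁ m₂ n₂ ∧ WAlgebraIso e m₂ n₂ m₁ n₁ := by
  let q : (UEA L ⧸ lidealC e m₁) →ₗ[ℂ] (UEA L ⧸ lidealC e m₂) :=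
    (lidealC e m₁).mapQ (lidealC e m₂) LinearMap.id fun u hu => lideal_mono hm hu
  have hq : ∀ u : UEA L, q (Submodule.Quotient.mk u) = Submodule.Quotient.mk u := fun u => rfl
  have hmap : ∀ p ∈ Hsub e m₁ n₁, q p ∈ Hsub e m₂ n₂ := by
    rintro _ ⟨u, hu, rfl⟩
    exact ⟨u, invSet_mono hm hn hu, rfl⟩
  let f : Hsub e m₁ n₁ →ₗ[ℂ] Hsub e m₂ n₂ := q.restrict hmap
  have hf : ∀ p, (f p : UEA L ⧸ lidealC e m₂) = q p := fun p => rfl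
  have hbij : Function.Bijective f := by
    constructor
    · rw [injective_iff_map_eq_zero]
      rintro ⟨_, u, hu, rfl⟩ h0
      have h1 : q (Submodule.Quotient.mk u) = 0 := congrArg Subtype.val h0
      rw [hq] at h1
      exact Subtype.ext ((Submodule.Quotient.mk_eq_zero _).mpr
        (h.1 u hu ((Submodule.Quotient.mk_eq_zero _).mp h1)))
    · rintro ⟨_, u, hu, rfl⟩
      obtain ⟨v, hv, huv⟩ := h.2 u hu
      exact ⟨⟨_, v, hv, rfl⟩, Subtype.ext (mk_eq_mk_iff.mpr huv).symm⟩
  let φ := LinearEquiv.ofBijective f hbij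
  have hφ : ∀ p, (φ p : UEA L ⧸ lidealC e m₂) = q p := fun p => rfl
  refine ⟨⟨φ, fun p hp => by rw [hφ, hp, hq], ?_⟩, ⟨φ.symm, fun p hp => ?_, ?_⟩⟩
  · rintro p₁ p₂ p₃ ⟨u, v, hu, hv, h₁, h₂, h₃⟩
    exact ⟨u, v, invSet_mono hm hn hu, invSet_mono hm hn hv, by rw [hφ, h₁, hq],
      by rw [hφ, h₂, hq], by rw [hφ, h₃, hq]⟩
  · let o : Hsub e m₁ n₁ := ⟨Submodule.Quotient.mk 1, 1, one_mem_invSet, rfl⟩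
    have ho : φ o = p := Subtype.ext (by rw [hφ, hp, hq])
    rw [← ho, LinearEquiv.symm_apply_apply]
  · rintro p₁ p₂ p₃ ⟨u', v', hu', hv', h₁, h₂, h₃⟩
    obtain ⟨u, hu, huu'⟩ := h.2 u' hu'
    obtain ⟨v, hv, hvv'⟩ := h.2 v' hv'
    have key : ∀ (p : Hsub e m₂ n₂) (w w' : UEA L) (_ : w ∈ invSet e m₁ n₁),
        (p : UEA L ⧸ lidealC e m₂) = Submodule.Quotient.mk w' → w' - w ∈ lideal e m₂ →
        (φ.symm p : UEA L ⧸ lidealC e m₁) = Submodule.Quotient.mk w := by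
      intro p w w' hw hp hww'
      let o : Hsub e m₁ n₁ := ⟨Submodule.Quotient.mk w, w, hw, rfl⟩
      have ho : φ o = p := Subtype.ext (by rw [hφ, hp, hq]; exact (mk_eq_mk_iff.mpr hww').symm)
      rw [← ho, LinearEquiv.symm_apply_apply]
    refine ⟨u, v, hu, hv, key _ _ _ hu h₁ huu', key _ _ _ hv h₂ hvv',
      key _ _ _ (mul_mem_invSet hmn₁ hu hv) h₃ ?_⟩
    convert add_mem (mul_mem_lideal_of_mem_invSet hmn₂ huu' hv') (mul_mem_lideal u hvv') using 1
    noncomm_ring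

lemma WAlgebraIso.refl (e : L) (m n : Submodule ℂ L) : WAlgebraIso e m n m n :=
  ⟨LinearEquiv.refl ℂ _, fun _ hp => hp, fun _ _ _ h => h⟩

lemma WAlgebraIso.trans {e : L} {m₁ n₁ m₂ n₂ m₃ n₃ : Submodule ℂ L}
    (h₁ : WAlgebraIso e m₁ n₁ m₂ n₂) (h₂ : WAlgebraIso e m₂ n₂ m₃ n₃) :
    WAlgebraIso e m₁ n₁ m₃ n₃ := by
  obtain ⟨φ, hφ₁, hφ⟩ := h₁
  obtain ⟨ψ, hψ₁, hψ⟩ := h₂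
  exact ⟨φ.trans ψ, fun p hp => hψ₁ _ (hφ₁ p hp), fun p q r h => hψ _ _ _ (hφ p q r h)⟩

end Enveloping

section Grading

variable {g : ℤ → Submodule ℂ L}

lemma IsZGrading.killingForm_eq_zero [FiniteDimensional ℂ L] (hg : IsZGrading g) {i j : ℤ}
    (hij : i + j ≠ 0) {x y : L} (hx : x ∈ g i) (hy : y ∈ g j) : killingForm ℂ L x y = 0 := by
  rw [killingForm_apply_apply]
  refine LinearMap.trace_eq_zero_of_mapsTo_ne hg.1 (fun k => i + (j + k)) (fun k => by omega) ?_
  intro k z hz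
  exact hg.2 _ _ _ hx _ (hg.2 _ _ _ hy _ hz)

lemma IsZGrading.ad_locally_nilpotent [FiniteDimensional ℂ L] (hg : IsZGrading g) {i : ℤ}
    (hi : i ≠ 0) {x : L} (hx : x ∈ g i) (z : L) : ∃ k : ℕ, (ad ℂ L x ^ k) z = 0 := by
  have hz : z ∈ ⨆ j, g j := by rw [hg.1.submodule_iSup_eq_top]; trivial
  induction hz using Submodule.iSup_induction' with
  | mem j z hz =>
    have hpow : ∀ k : ℕ, (ad ℂ L x ^ k) z ∈ g (k * i + j) := fun k => by
      induction k with
      | zero => simpa using hz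
      | succ k ih =>
        rw [pow_succ', Module.End.mul_apply, ad_apply]
        convert hg.2 _ _ _ hx _ ih using 2
        push_cast
        ring
    have hfin : {k | g k ≠ ⊥}.Finite :=
      WellFoundedGT.finite_ne_bot_of_iSupIndep hg.1.submodule_iSupIndep
    have hinj : Function.Injective fun k : ℕ => (k : ℤ) * i + j := fun k l hkl => by
      have := mul_right_cancel₀ hi (add_right_cancel hkl)
      exact_mod_cast this
    by_contra! hne
    refine Set.infinite_range_of_injective hinj (hfin.subset ?_)
    rintro _ ⟨k, rfl⟩ hbot
    have hk := hpow k
    simp only at hbot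
    rw [hbot, Submodule.mem_bot] at hk
    exact hne k hk
  | zero => exact ⟨0, by simp⟩
  | add u v _ _ hu hv => exact exists_pow_apply_add_eq_zero hu hv

lemma le_of_homogeneous_le {n p : Submodule ℂ L} (hn : n ≤ ⨆ j, g j ⊓ n)
    (h : ∀ j, ∀ x ∈ g j, x ∈ n → x ∈ p) : n ≤ p :=
  hn.trans (iSup_le fun j x hx => h j x hx.1 hx.2)

lemma IsZGrading.neg_of_ne_zero (hg : IsZGrading g) {x : L} {j : ℤ} (hx : x ∈ g j)
    (hx' : x ∈ ⨆ k < (0 : ℤ), g k) (h0 : x ≠ 0) : j < 0 := by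
  by_contra hj
  refine h0 ((Submodule.disjoint_def.mp (hg.1.submodule_iSupIndep j)) x hx ?_)
  refine (iSup₂_le fun k hk => ?_ : (⨆ k < (0 : ℤ), g k) ≤ _) hx'
  exact le_iSup₂_of_le k (by omega) le_rfl

/-- Two nested pairs `𝔪 ⊆ 𝔪' ⊆ 𝔫' ⊆ 𝔫` for which `χ([·,·])` induces a perfect pairing of
`𝔫 / 𝔫'` with `𝔪' / 𝔪`. -/
structure NestedPairs (g : ℤ → Submodule ℂ L) (e : L) (a : ℤ)
    (m n m' n' : Submodule ℂ L) : Prop where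
  lie_n : ∀ x ∈ n, ∀ y ∈ n, ⁅x, y⁆ ∈ n
  stab : ∀ x ∈ n, ∀ y ∈ m, ⁅x, y⁆ ∈ m ∧ killingForm ℂ L e ⁅x, y⁆ = 0
  stab' : ∀ x ∈ n', ∀ y ∈ m', ⁅x, y⁆ ∈ m' ∧ killingForm ℂ L e ⁅x, y⁆ = 0
  graded_n : n ≤ ⨆ j, g j ⊓ n
  graded_m' : m' ≤ ⨆ j, g j ⊓ m'
  le_m : ⨆ j ≤ -a, g j ≤ m
  n_le : n ≤ ⨆ j < (0 : ℤ), g j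
  m_le : m ≤ m'
  m'_le : m' ≤ n'
  n'_le : n' ≤ n
  mem_n' : ∀ x ∈ n, (∀ y ∈ m', killingForm ℂ L e ⁅x, y⁆ = 0) → x ∈ n'
  mem_m : ∀ y ∈ m', (∀ x ∈ n, killingForm ℂ L e ⁅x, y⁆ = 0) → y ∈ m

lemma NestedPairs.exists_line [FiniteDimensional ℂ L] (hg : IsZGrading g) {e : L} {a : ℤ}
    (he : e ∈ g a) {m n m' n' : Submodule ℂ L} (h : NestedPairs g e a m n m' n')
    (hne : ¬ m' ≤ m) :
    ∃ m₁ n₁, m < m₁ ∧ NestedPairs g e a m₁ n₁ m' n' ∧ NaturalMapBijective e m n m₁ n₁ ∧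
      n₁ ≤ n := by
  have hχ : ∀ {k : ℤ}, k ≠ -a → ∀ z ∈ g k, killingForm ℂ L e z = 0 := fun hk z hz =>
    hg.killingForm_eq_zero (by omega) he hz
  have hlow : ∀ {k : ℤ}, k ≤ -a → ∀ z ∈ g k, z ∈ m := fun {k} hk z hz =>
    h.le_m (le_iSup₂_of_le (f := fun (j : ℤ) (_ : j ≤ -a) => g j) k hk le_rfl hz)
  obtain ⟨d, ⟨y, hyd, hym', hym⟩, hmin⟩ :=
    Int.exists_least_of_bdd (P := fun j => ∃ y ∈ g j, y ∈ m' ∧ y ∉ m)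
      ⟨-a, fun j ⟨y, hyj, _, hym⟩ => by
        by_contra hj
        exact hym (hlow (by omega) y hyj)⟩
      (by
        by_contra! hcon
        exact hne (le_of_homogeneous_le h.graded_m' fun j y hy hy' => hcon j y hy hy'))
  have hbelow : ∀ {k : ℤ}, k < d → ∀ z ∈ g k, z ∈ m' → z ∈ m := fun {k} hk z hz hz' => by
    by_contra hzm
    exact absurd (hmin k ⟨z, hz, hz', hzm⟩) (by omega)
  have hd : -a < d := by
    by_contra hd
    exact hym (hlow (by omega) y hyd)
  have hyn : y ∈ n := h.n'_le (h.m'_le hym')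
  have hny : ∀ x ∈ n, ⁅x, y⁆ ∈ m := by
    suffices n ≤ m.comap (ad ℂ L y) from fun x hx => by
      rw [← lie_skew, neg_mem_iff]; exact this hx
    refine le_of_homogeneous_le h.graded_n fun j x hxj hxn => ?_
    rw [Submodule.mem_comap, ad_apply, ← lie_skew, neg_mem_iff]
    by_cases hj : j + d ≤ -a
    · exact hlow hj _ (hg.2 _ _ _ hxj _ hyd)
    by_cases hx0 : x = 0
    · simp [hx0]
    have hj0 := hg.neg_of_ne_zero hxj (h.n_le hxn) hx0
    have hxn' : x ∈ n' := by
      refine h.mem_n' x hxn ?_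
      have : m' ≤ LinearMap.ker ((killingForm ℂ L e).comp (ad ℂ L x)) := by
        refine le_of_homogeneous_le h.graded_m' fun k z hzk hz => ?_
        rw [LinearMap.mem_ker, LinearMap.comp_apply, ad_apply]
        by_cases hk : k < d
        · exact (h.stab x hxn z (hbelow hk z hzk hz)).2
        · exact hχ (by omega) _ (hg.2 _ _ _ hxj _ hzk)
      exact fun z hz => this hz
    exact hbelow (by omega) _ (hg.2 _ _ _ hxj _ hyd) (h.stab' x hxn' y hym').1
  obtain ⟨j, x, hxj, hxn, hxy⟩ : ∃ j, ∃ x ∈ g j, x ∈ n ∧ killingForm ℂ L e ⁅x, y⁆ = 1 := by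
    by_contra! hcon
    refine hym (h.mem_m y hym' fun x hx => ?_)
    have : n ≤ LinearMap.ker ((killingForm ℂ L e).comp (ad ℂ L y)) := by
      refine le_of_homogeneous_le h.graded_n fun j x hxj hxn => ?_
      rw [LinearMap.mem_ker, LinearMap.comp_apply, ad_apply, ← lie_skew, map_neg, neg_eq_zero]
      by_contra hc
      refine hcon j ((killingForm ℂ L e ⁅x, y⁆)⁻¹ • x) ((g j).smul_mem _ hxj)
        (n.smul_mem _ hxn) ?_
      rw [smul_lie, map_smul, smul_eq_mul, inv_mul_cancel₀ hc]
    have hx' := this hx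
    rwa [LinearMap.mem_ker, LinearMap.comp_apply, ad_apply, ← lie_skew, map_neg,
      neg_eq_zero] at hx'
  have hjd : j + d = -a := by
    by_contra hjd
    rw [hχ hjd _ (hg.2 _ _ _ hxj _ hyd)] at hxy
    exact zero_ne_one hxy
  have hx0 : x ≠ 0 := fun h0 => by simp [h0] at hxy
  have hj0 := hg.neg_of_ne_zero hxj (h.n_le hxn) hx0
  let n₁ : Submodule ℂ L := n ⊓ LinearMap.ker ((killingForm ℂ L e).comp (ad ℂ L y))
  have hn₁ : ∀ z, z ∈ n₁ ↔ z ∈ n ∧ killingForm ℂ L e ⁅z, y⁆ = 0 := fun z => by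
    rw [Submodule.mem_inf, LinearMap.mem_ker, LinearMap.comp_apply, ad_apply, ← lie_skew, map_neg,
      neg_eq_zero]
  have hn₁n : n₁ ≤ n := inf_le_left
  let m₁ : Submodule ℂ L := m ⊔ Submodule.span ℂ {y}
  have hm₁ : ∀ w ∈ m₁, ∃ v ∈ m, ∃ c : ℂ, w = v + c • y := fun w hw => by
    obtain ⟨v, hv, _, hs, rfl⟩ := Submodule.mem_sup.mp hw
    obtain ⟨c, rfl⟩ := Submodule.mem_span_singleton.mp hs
    exact ⟨v, hv, c, rfl⟩
  have hmm₁ : m ≤ m₁ := le_sup_left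
  have hym₁ : y ∈ m₁ := Submodule.mem_sup_right (Submodule.mem_span_singleton_self y)
  have hlien : ∀ z ∈ n, ∀ w ∈ n, ⁅z, w⁆ ∈ n₁ := fun z hz w hw => by
    refine (hn₁ _).mpr ⟨h.lie_n z hz w hw, ?_⟩
    rw [lie_lie, map_sub, (h.stab z hz _ (hny w hw)).2, (h.stab w hw _ (hny z hz)).2, sub_zero]
  have hsplit : ∀ z ∈ n, z - killingForm ℂ L e ⁅z, y⁆ • x ∈ n₁ := fun z hz => by
    refine (hn₁ _).mpr ⟨sub_mem hz (n.smul_mem _ hxn), ?_⟩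
    rw [sub_lie, smul_lie, map_sub, map_smul, hxy, smul_eq_mul, mul_one, sub_self]
  have hstab₁ : ∀ z ∈ n₁, ∀ w ∈ m₁, ⁅z, w⁆ ∈ m₁ ∧ killingForm ℂ L e ⁅z, w⁆ = 0 := by
    intro z hz w hw
    obtain ⟨v, hv, c, rfl⟩ := hm₁ w hw
    rw [hn₁] at hz
    rw [lie_add, lie_smul, map_add, map_smul, hz.2, (h.stab z hz.1 v hv).2, smul_zero, add_zero]
    exact ⟨hmm₁ (add_mem (h.stab z hz.1 v hv).1 (m.smul_mem c (hny z hz.1))), rfl⟩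
  refine ⟨m₁, n₁, ?_, ?_, ?_, hn₁n⟩
  · exact lt_of_le_of_ne hmm₁ fun heq => hym (heq ▸ hym₁)
  · refine ⟨fun z hz w hw => hlien z (hn₁n hz) w (hn₁n hw), hstab₁, h.stab', ?_, h.graded_m',
      h.le_m.trans hmm₁, hn₁n.trans h.n_le, ?_, h.m'_le, ?_, ?_, ?_⟩
    · let P : L →ₗ[ℂ] L :=
        LinearMap.id + ((killingForm ℂ L e).comp (ad ℂ L y)).smulRight x
      have hP : ∀ z, P z = z - killingForm ℂ L e ⁅z, y⁆ • x := fun z => by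
        rw [← lie_skew z y, map_neg, neg_smul, sub_neg_eq_add]
        rfl
      have hPn : n ≤ (⨆ j, g j ⊓ n₁).comap P := by
        refine le_of_homogeneous_le h.graded_n fun k z hzk hz => ?_
        rw [Submodule.mem_comap]
        refine Submodule.mem_iSup_of_mem k ⟨?_, hP z ▸ hsplit z hz⟩
        rw [SetLike.mem_coe, hP]
        by_cases hk : k = j
        · subst hk
          exact sub_mem hzk ((g k).smul_mem _ hxj)
        · rw [hχ (by omega) _ (hg.2 _ _ _ hzk _ hyd), zero_smul, sub_zero]
          exact hzk
      intro z hz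
      have hz' := hPn (hn₁n hz)
      rwa [Submodule.mem_comap, hP, ((hn₁ z).mp hz).2, zero_smul, sub_zero] at hz'
    · exact sup_le h.m_le ((Submodule.span_singleton_le_iff_mem _ _).mpr hym')
    · exact fun z hz => (hn₁ z).mpr ⟨h.n'_le hz, (h.stab' z hz y hym').2⟩
    · exact fun z hz => h.mem_n' z (hn₁n hz)
    · intro w hw hw₁
      have hwm : w - killingForm ℂ L e ⁅x, w⁆ • y ∈ m := by
        refine h.mem_m _ (sub_mem hw (m'.smul_mem _ hym')) fun z hz => ?_
        have h1 := hw₁ _ (hsplit z hz)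
        rw [sub_lie, smul_lie, map_sub, map_smul, smul_eq_mul] at h1
        rw [lie_sub, lie_smul, map_sub, map_smul, smul_eq_mul, mul_comm]
        exact h1
      simpa using add_mem (hmm₁ hwm) (m₁.smul_mem (killingForm ℂ L e ⁅x, w⁆) hym₁)
  · refine naturalMapBijective_of_line h.stab hstab₁ rfl hn₁n ?_ hxn ?_ (hny x hxn) hxy
      (fun z hz => hlien x hxn z (hn₁n hz)) (hg.ad_locally_nilpotent hj0.ne hxj)
    · intro z hz
      rw [← sub_add_cancel z (killingForm ℂ L e ⁅z, y⁆ • x)]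
      exact add_mem (Submodule.mem_sup_left (hsplit z hz)) (Submodule.mem_sup_right
        (Submodule.smul_mem _ _ (Submodule.mem_span_singleton_self x)))
    · intro z hz
      rw [← lie_skew, neg_mem_iff, map_neg, neg_eq_zero]
      exact h.stab y hyn z hz

lemma NestedPairs.naturalMapBijective [FiniteDimensional ℂ L] (hg : IsZGrading g) {e : L} {a : ℤ}
    (he : e ∈ g a) {m' n' : Submodule ℂ L} (m : Submodule ℂ L) :
    ∀ n, NestedPairs g e a m n m' n' → NaturalMapBijective e m n m' n' := by
  induction m using WellFoundedGT.induction with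
  | ind m ih =>
    intro n h
    by_cases hle : m' ≤ m
    · obtain rfl := le_antisymm hle h.m_le
      obtain rfl : n' = n := le_antisymm h.n'_le fun x hx =>
        h.mem_n' x hx fun y hy => (h.stab x hx y hy).2
      exact ⟨fun _ _ hu => hu, fun u hu => ⟨u, hu, by rw [sub_self]; exact zero_mem _⟩⟩
    · obtain ⟨m₁, n₁, hlt, h₁, hbij, hn₁⟩ := h.exists_line hg he hle
      exact hbij.trans hlt.le hn₁ h₁.m_le (ih m₁ hlt n₁ h₁)

end Grading

section Admissible

variable {g : ℤ → Submodule ℂ L} {e : L} {a : ℤ}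

lemma killingForm_lie_eq (e x y : L) : killingForm ℂ L e ⁅x, y⁆ = killingForm ℂ L y ⁅e, x⁆ := by
  rw [LieModule.traceForm_comm ℂ L L y]
  exact (LieModule.traceForm_apply_lie_apply ℂ L L e x y).symm

lemma mem_orthogonal_killingForm_iff {m : Submodule ℂ L} {x : L} :
    ⁅e, x⁆ ∈ LinearMap.BilinForm.orthogonal (killingForm ℂ L) m ↔
      ∀ y ∈ m, killingForm ℂ L e ⁅x, y⁆ = 0 := by
  simp only [LinearMap.BilinForm.mem_orthogonal_iff, killingForm_lie_eq e x]

lemma IsAdmissiblePair.killingForm_lie_eq_zero {m n : Submodule ℂ L}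
    (h : IsAdmissiblePair g e a m n) : ∀ x ∈ n, ∀ y ∈ m, killingForm ℂ L e ⁅x, y⁆ = 0 := by
  obtain ⟨-, -, -, -, -, -, -, hA3, -⟩ := h
  intro x hx
  have : ⁅e, x⁆ ∈ Submodule.map (ad ℂ L e) n := ⟨x, hx, rfl⟩
  rw [← hA3] at this
  exact mem_orthogonal_killingForm_iff.mp this.1

lemma IsAdmissiblePair.mem_of_forall_killingForm_lie_eq_zero [FiniteDimensional ℂ L]
    [LieAlgebra.IsKilling ℂ L] {m n : Submodule ℂ L}
    (h : IsAdmissiblePair g e a m n) {y : L} (hy : y ∈ n)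
    (hy' : ∀ x ∈ n, killingForm ℂ L e ⁅x, y⁆ = 0) : y ∈ m := by
  obtain ⟨-, -, -, -, -, hmn, -, hA3, hA4, -⟩ := h
  have hnd := LieAlgebra.IsKilling.killingForm_nondegenerate ℂ L
  have hrefl : LinearMap.BilinForm.IsRefl (killingForm ℂ L) :=
    (LieModule.traceForm_isSymm ℂ L L).isRefl
  have hker : LinearMap.BilinForm.orthogonal (killingForm ℂ L) (LinearMap.ker (ad ℂ L e)) ≤
      LinearMap.range (ad ℂ L e) := by
    rw [← LinearMap.BilinForm.orthogonal_orthogonal hnd hrefl (LinearMap.range (ad ℂ L e))]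
    refine LinearMap.BilinForm.orthogonal_le fun w hw => ?_
    rw [LinearMap.mem_ker, ad_apply]
    refine hnd.1 _ fun z => ?_
    have h1 : killingForm ℂ L ⁅e, z⁆ w = 0 :=
      LinearMap.BilinForm.mem_orthogonal_iff.mp hw ⁅e, z⁆ ⟨z, rfl⟩
    rw [LieModule.traceForm_comm, ← killingForm_lie_eq] at h1
    rw [LieModule.traceForm_apply_lie_apply, ← lie_skew, map_neg, h1, neg_zero]
  have hyW : y ∈ m ⊔ LinearMap.ker (ad ℂ L e) := by
    rw [← LinearMap.BilinForm.orthogonal_orthogonal hnd hrefl (m ⊔ LinearMap.ker (ad ℂ L e)),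
      LinearMap.BilinForm.mem_orthogonal_iff]
    intro w hw
    have hw' : w ∈ Submodule.map (ad ℂ L e) n := hA3 ▸
      ⟨LinearMap.BilinForm.orthogonal_le le_sup_left hw,
        hker (LinearMap.BilinForm.orthogonal_le le_sup_right hw)⟩
    obtain ⟨x, hx, rfl⟩ := hw'
    have h1 := hy' x hx
    rw [killingForm_lie_eq, LieModule.traceForm_comm] at h1
    exact h1
  obtain ⟨v, hv, w, hw, rfl⟩ := Submodule.mem_sup.mp hyW
  have hw0 : w ∈ n ⊓ LinearMap.ker (ad ℂ L e) :=
    ⟨by simpa using sub_mem hy (hmn hv), hw⟩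
  rw [hA4, Submodule.mem_bot] at hw0
  rwa [hw0, add_zero]

lemma nestedPairs_of_isAdmissiblePair [FiniteDimensional ℂ L] [LieAlgebra.IsKilling ℂ L]
    {m n m' n' : Submodule ℂ L} (h : IsAdmissiblePair g e a m n)
    (h' : IsAdmissiblePair g e a m' n') (hm : m ≤ m') (hn : n' ≤ n) :
    NestedPairs g e a m n m' n' := by
  have hχ := h.killingForm_lie_eq_zero
  have hχ' := h'.killingForm_lie_eq_zero
  have hmem := fun y => h.mem_of_forall_killingForm_lie_eq_zero (y := y)
  obtain ⟨-, hn_lie, -, hn_gr, hlow, -, hneg, -, hA4, hA5, -⟩ := h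
  obtain ⟨-, -, hm'_gr, -, -, hmn', -, hA3', -, hA5', -⟩ := h'
  refine ⟨hn_lie, fun x hx y hy => ⟨hA5 x hx y hy, hχ x hx y hy⟩,
    fun x hx y hy => ⟨hA5' x hx y hy, hχ' x hx y hy⟩, hn_gr.le, hm'_gr.le, hlow, hneg, hm, hmn',
    hn, fun x hx hxy => ?_, fun y hy => hmem y (hn (hmn' hy))⟩
  have h1 : ⁅e, x⁆ ∈ Submodule.map (ad ℂ L e) n' := hA3' ▸
    ⟨mem_orthogonal_killingForm_iff.mpr hxy, ⟨x, rfl⟩⟩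
  obtain ⟨x', hx', hxx'⟩ := h1
  have h2 : x - x' ∈ n ⊓ LinearMap.ker (ad ℂ L e) := by
    refine ⟨sub_mem hx (hn hx'), ?_⟩
    rw [SetLike.mem_coe, LinearMap.mem_ker, map_sub, hxx', ad_apply, sub_self]
  rw [hA4, Submodule.mem_bot, sub_eq_zero] at h2
  exact h2 ▸ hx'

lemma ComparablePairs.wAlgebraIso [FiniteDimensional ℂ L] [LieAlgebra.IsKilling ℂ L]
    {p q : Submodule ℂ L × Submodule ℂ L} (h : ComparablePairs e p q) :
    WAlgebraIso e p.1 p.2 q.1 q.2 := by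
  obtain ⟨g, a, hg, -, he, hp, hq, hpq⟩ := h
  have hp' := hp.2.2.2.2.2.1
  have hq' := hq.2.2.2.2.2.1
  rcases hpq with ⟨hm, -, hn⟩ | ⟨hm, -, hn⟩
  · exact (wAlgebraIso_of_naturalMapBijective hm hn hp' hq' (NestedPairs.naturalMapBijective hg he
      _ _ (nestedPairs_of_isAdmissiblePair hp hq hm hn))).1
  · exact (wAlgebraIso_of_naturalMapBijective hm hn hq' hp' (NestedPairs.naturalMapBijective hg he
      _ _ (nestedPairs_of_isAdmissiblePair hq hp hm hn))).2

end Admissible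

/-- **Theorem 4.11 (Sadaka).** If two `e`-admissible pairs `(𝔪, 𝔫)` and `(𝔪′, 𝔫′)` are
equivalent (joined by a finite chain of `e`-admissible pairs with consecutive pairs
comparable), then the finite W-algebras `H(𝔪, 𝔫)` and `H(𝔪′, 𝔫′)` are isomorphic. -/
theorem stmt_12 {L : Type*} [LieRing L] [LieAlgebra ℂ L]
    [FiniteDimensional ℂ L] [LieAlgebra.IsSimple ℂ L]
    (e : L) (he : IsNilpotent (ad ℂ L e))
    (m₁ n₁ m₂ n₂ : Submodule ℂ L)
    (hadm₁ : ∃ (g : ℤ → Submodule ℂ L) (a : ℤ), IsZGrading g ∧ 1 < a ∧ e ∈ g a ∧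
      IsAdmissiblePair g e a m₁ n₁)
    (hadm₂ : ∃ (g : ℤ → Submodule ℂ L) (a : ℤ), IsZGrading g ∧ 1 < a ∧ e ∈ g a ∧
      IsAdmissiblePair g e a m₂ n₂)
    (hequiv : EquivalentPairs e (m₁, n₁) (m₂, n₂)) :
    WAlgebraIso e m₁ n₁ m₂ n₂ := by
  obtain ⟨q, hq, rfl, rfl⟩ : ∃ q, EquivalentPairs e (m₁, n₁) q ∧ q.1 = m₂ ∧ q.2 = n₂ :=
    ⟨_, hequiv, rfl, rfl⟩
  clear hequiv hadm₂
  induction hq with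
  | refl => exact WAlgebraIso.refl e m₁ n₁
  | tail _ h ih => exact ih.trans h.wAlgebraIso
end
end

section
/- Let Γ : 𝔤 = ⊕_{j∈ℚ} 𝔤_j be a grading of 𝔤 with e ∈ 𝔤_a for an integer a ≥ 2, let b ∈ ℚ, and consider the bilinear form Φ_e : 𝔤_{−b} × 𝔤_{b−a} → ℂ, (x,y) ↦ ⟨e,[x,y]⟩. If V is a vector space complement of 𝔤_{−b} ∩ 𝔤^e in 𝔤_{−b} and W is a vector space complement of 𝔤_{b−a} ∩ 𝔤^e in 𝔤_{b−a}, then the restriction of Φ_e to V × W is nondegenerate; in particular dim V = dim W. -/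
open Module LieAlgebra

namespace LieAlgebra

variable {K L ι : Type*} [Field K] [LieRing L] [LieAlgebra K L] [FiniteDimensional K L]
  [AddCommGroup ι] [DecidableEq ι] {g : ι → Submodule K L}

lemma killingForm_eq_zero_of_grading (hInt : DirectSum.IsInternal g)
    (hbr : ∀ i j : ι, ∀ x ∈ g i, ∀ y ∈ g j, ⁅x, y⁆ ∈ g (i + j))
    {i j : ι} (hij : i + j ≠ 0) {x y : L} (hx : x ∈ g i) (hy : y ∈ g j) :
    killingForm K L x y = 0 := by
  rw [killingForm_apply_apply]
  refine LinearMap.trace_eq_zero_of_mapsTo_ne hInt (fun k ↦ i + (j + k)) (fun k h ↦ ?_)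
    fun k z hz ↦ hbr _ _ _ hx _ (hbr _ _ _ hy _ hz)
  exact hij (by simpa [← add_assoc] using h)

lemma eq_zero_of_killingForm_eq_zero_of_grading [IsKilling K L] (hInt : DirectSum.IsInternal g)
    (hbr : ∀ i j : ι, ∀ x ∈ g i, ∀ y ∈ g j, ⁅x, y⁆ ∈ g (i + j))
    {i j : ι} (hij : i + j = 0) {x : L} (hx : x ∈ g i)
    (h : ∀ y ∈ g j, killingForm K L x y = 0) : x = 0 := by
  suffices x ∈ LinearMap.ker (killingForm K L) by simpa using this
  suffices (⊤ : Submodule K L) ≤ LinearMap.ker (killingForm K L x) from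
    LinearMap.ext fun y ↦ this (Submodule.mem_top (x := y))
  rw [← hInt.submodule_iSup_eq_top, iSup_le_iff]
  intro k y hy
  by_cases hk : k = j
  · exact h y (hk ▸ hy)
  · refine killingForm_eq_zero_of_grading hInt hbr (fun h0 ↦ hk ?_) hx hy
    exact add_left_cancel (h0.trans hij.symm)

/-- The form `(x, y) ↦ ⟨e, [x, y]⟩` on `g i × g j`, where `e` is homogeneous of degree
`-(i + j)`, is left-separating on complements of the centralizer of `e`. -/
lemma eq_zero_of_killingForm_lie_eq_zero_of_grading [IsKilling K L]
    (hInt : DirectSum.IsInternal g)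
    (hbr : ∀ i j : ι, ∀ x ∈ g i, ∀ y ∈ g j, ⁅x, y⁆ ∈ g (i + j))
    {a i j : ι} (hij : a + i + j = 0) {e : L} (he : e ∈ g a) {V W : Submodule K L}
    (hV : V ≤ g i) (hVe : V ⊓ (g i ⊓ LinearMap.ker (ad K L e)) = ⊥)
    (hW : g j ≤ W ⊔ (g j ⊓ LinearMap.ker (ad K L e)))
    {x : L} (hx : x ∈ V) (h : ∀ y ∈ W, killingForm K L e ⁅x, y⁆ = 0) : x = 0 := by
  suffices hex : ⁅e, x⁆ = 0 by
    rw [← Submodule.mem_bot K, ← hVe]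
    exact ⟨hx, hV hx, hex⟩
  refine eq_zero_of_killingForm_eq_zero_of_grading hInt hbr hij (hbr _ _ _ he _ (hV hx))
    fun y hy ↦ ?_
  obtain ⟨w, hw, z, ⟨-, hz⟩, rfl⟩ := Submodule.mem_sup.mp (hW hy)
  have hez : ⁅e, z⁆ = 0 := hz
  have hxz : killingForm K L ⁅e, x⁆ z = 0 := by
    rw [← lie_skew, map_neg, LinearMap.neg_apply, LieModule.traceForm_apply_lie_apply, hez,
      map_zero, neg_zero]
  rw [map_add, hxz, add_zero, LieModule.traceForm_apply_lie_apply, h w hw]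

end LieAlgebra

lemma Submodule.finrank_le_of_separatingLeft {K M : Type*} [Field K] [AddCommGroup M] [Module K M]
    [FiniteDimensional K M] (B : M →ₗ[K] M →ₗ[K] K) {V W : Submodule K M}
    (h : ∀ x ∈ V, (∀ y ∈ W, B x y = 0) → x = 0) :
    Module.finrank K V ≤ Module.finrank K W := by
  rw [← Subspace.dual_finrank_eq (V := W)]
  refine LinearMap.finrank_le_finrank_of_injective (f := B.domRestrict₁₂ V W) ?_
  rw [← LinearMap.ker_eq_bot, LinearMap.ker_eq_bot']
  intro x hx
  exact Subtype.ext (h x x.2 fun y hy ↦ LinearMap.congr_fun hx ⟨y, hy⟩)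

/-- **Lemma 6.1 (Sadaka).** Let `Γ : 𝔤 = ⊕_{j∈ℚ} 𝔤_j` be a grading of the
finite-dimensional complex simple Lie algebra `𝔤` with `e ∈ 𝔤_a` for an integer `a ≥ 2`,
let `b ∈ ℚ` and consider `Φ_e : 𝔤_{−b} × 𝔤_{b−a} → ℂ`, `(x, y) ↦ ⟨e, [x, y]⟩`.  If `V`
(resp. `W`) is a complement of `𝔤_{−b} ∩ 𝔤^e` in `𝔤_{−b}` (resp. of `𝔤_{b−a} ∩ 𝔤^e` in
`𝔤_{b−a}`), then the restriction of `Φ_e` to `V × W` is nondegenerate; in particular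
`dim V = dim W`. -/
theorem stmt_16 {L : Type*} [LieRing L] [LieAlgebra ℂ L]
    [FiniteDimensional ℂ L] [LieAlgebra.IsSimple ℂ L]
    (e : L) (he : IsNilpotent (ad ℂ L e))
    (g : ℚ → Submodule ℂ L)
    (hInt : DirectSum.IsInternal g)
    (hbr : ∀ i j : ℚ, ∀ x ∈ g i, ∀ y ∈ g j, ⁅x, y⁆ ∈ g (i + j))
    (a : ℤ) (ha : 2 ≤ a) (hea : e ∈ g (a : ℚ))
    (b : ℚ) (V W : Submodule ℂ L)
    (hV1 : V ≤ g (-b)) (hV2 : V ⊓ (g (-b) ⊓ LinearMap.ker (ad ℂ L e)) = ⊥)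
    (hV3 : V ⊔ (g (-b) ⊓ LinearMap.ker (ad ℂ L e)) = g (-b))
    (hW1 : W ≤ g (b - a)) (hW2 : W ⊓ (g (b - a) ⊓ LinearMap.ker (ad ℂ L e)) = ⊥)
    (hW3 : W ⊔ (g (b - a) ⊓ LinearMap.ker (ad ℂ L e)) = g (b - a)) :
    (∀ x ∈ V, (∀ y ∈ W, killingForm ℂ L e ⁅x, y⁆ = 0) → x = 0) ∧
    (∀ y ∈ W, (∀ x ∈ V, killingForm ℂ L e ⁅x, y⁆ = 0) → y = 0) ∧
    Module.finrank ℂ ↥V = Module.finrank ℂ ↥W := by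
  have hl : ∀ x ∈ V, (∀ y ∈ W, killingForm ℂ L e ⁅x, y⁆ = 0) → x = 0 := fun x hx h ↦
    eq_zero_of_killingForm_lie_eq_zero_of_grading hInt hbr (by ring) hea hV1 hV2 hW3.ge hx h
  have hr : ∀ y ∈ W, (∀ x ∈ V, killingForm ℂ L e ⁅x, y⁆ = 0) → y = 0 := fun y hy h ↦
    eq_zero_of_killingForm_lie_eq_zero_of_grading hInt hbr (by ring) hea hW1 hW2 hV3.ge hy
      fun x hx ↦ by rw [← lie_skew, map_neg, h x hx, neg_zero]
  let B : L →ₗ[ℂ] L →ₗ[ℂ] ℂ := (ad ℂ L : L →ₗ[ℂ] Module.End ℂ L).compr₂ (killingForm ℂ L e)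
  exact ⟨hl, hr, le_antisymm (Submodule.finrank_le_of_separatingLeft B hl)
    (Submodule.finrank_le_of_separatingLeft B.flip hr)⟩
end
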